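/- arXiv:1905.05797 — 3 statements merged into one kernel-verified Lean document; each statement's English description precedes it below -/
import Mathlib

section
/- Let M be a positive integer, let A₁, A₂ be real symmetric M×M matrices, b₁, b₂ ∈ ℝ^M, and c₁, c₂ ∈ ℝ, and define the quadratic functions φₖ(o) = oᵀAₖo + 2bₖᵀo + cₖ for k = 1, 2. Suppose there exists a point õ ∈ ℝ^M with φ₂(õ) < 0 (Slater condition). Then the implication 'φ₂(o) ≤ 0 ⟹ φ₁(o) ≥ 0' holds for every o ∈ ℝ^M if and only if there exists κ ≥ 0 such that the (M+1)×(M+1) block matrix [[A₁ + κA₂, b₁ + κb₂], [(b₁ + κb₂)ᵀ, c₁ + κc₂]] is positive semidefinite. -/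
open Matrix

/-- If `f + c * t + g * t ^ 2` is nonnegative wherever `a + b * t + d * t ^ 2` vanishes, with
`a < 0 < d`, then `g * a ≤ f * d`. -/
theorem mul_le_mul_of_nonneg_on_roots {a b d f c g : ℝ} (ha : a < 0) (hd : 0 < d)
    (h : ∀ t, a + b * t + d * t ^ 2 = 0 → 0 ≤ f + c * t + g * t ^ 2) : g * a ≤ f * d := by
  set r := √(b ^ 2 - 4 * a * d)
  have had : 0 < -a * d := mul_pos (neg_pos.2 ha) hd
  have hr : r ^ 2 = b ^ 2 - 4 * a * d := Real.sq_sqrt (by nlinarith [sq_nonneg b])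
  have hbr : |b| < r := abs_lt_of_sq_lt_sq (by linarith) (Real.sqrt_nonneg _)
  obtain ⟨hb₁, hb₂⟩ := abs_lt.1 hbr
  have h₁ := h ((-b + r) / (2 * d)) (by field_simp; linarith)
  have h₂ := h ((-b - r) / (2 * d)) (by field_simp; linarith)
  have hrpos : 0 < r := (abs_nonneg b).trans_lt hbr
  have key : (b + r) * (f + c * ((-b + r) / (2 * d)) + g * ((-b + r) / (2 * d)) ^ 2) +
      (r - b) * (f + c * ((-b - r) / (2 * d)) + g * ((-b - r) / (2 * d)) ^ 2) =
      2 * r / d * (f * d - g * a) := by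
    field_simp
    linear_combination (2 * g * r) * hr
  have hnn : 0 ≤ 2 * r / d * (f * d - g * a) := by
    rw [← key]
    exact add_nonneg (mul_nonneg (by linarith) h₁) (mul_nonneg (by linarith) h₂)
  linarith [nonneg_of_mul_nonneg_right hnn (by positivity)]

/-- A quadratic polynomial that is nonnegative on `[0, ∞)` has a nonnegative leading coefficient. -/
theorem nonneg_of_forall_quadratic_nonneg {a b c : ℝ}
    (h : ∀ t, 0 ≤ t → 0 ≤ a + b * t + c * t ^ 2) : 0 ≤ c := by
  by_contra! hc
  have ht := h ((|a| + |b| + 1) / -c + 1) (by have := neg_pos.2 hc; positivity)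
  set t := (|a| + |b| + 1) / -c + 1
  have hct : c * t = -(|a| + |b| + 1) + c := by
    simp only [t]; field_simp [hc.ne]
  have ht1 : 1 ≤ t := by
    have : 0 ≤ (|a| + |b| + 1) / -c := div_nonneg (by positivity) (by linarith)
    simp only [t]; linarith
  have : a + b * t + c * t ^ 2 = a + (b - (|a| + |b| + 1) + c) * t := by
    linear_combination t * hct
  nlinarith [le_abs_self a, le_abs_self b, abs_nonneg a]

theorem QuadraticMap.map_add_smul_eq {V : Type*} [AddCommGroup V] [Module ℝ V]
    (Q : QuadraticForm ℝ V) (x y : V) (t : ℝ) :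
    Q (x + t • y) = Q x + QuadraticMap.polar Q x y * t + Q y * t ^ 2 := by
  rw [QuadraticMap.map_add Q, QuadraticMap.map_smul, QuadraticMap.polar_smul_right]
  simp only [smul_eq_mul]
  ring

/-- The homogeneous S-lemma. -/
theorem QuadraticMap.exists_nonneg_add_mul_nonneg {V : Type*} [AddCommGroup V] [Module ℝ V]
    (F G : QuadraticForm ℝ V) (hG : ∃ z, G z < 0) (h : ∀ x, G x ≤ 0 → 0 ≤ F x) :
    ∃ κ : ℝ, 0 ≤ κ ∧ ∀ x, 0 ≤ F x + κ * G x := by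
  have cross {x y : V} (hx : G x < 0) (hy : 0 < G y) : -F y / G y ≤ F x / -G x := by
    rw [div_le_div_iff₀ hy (neg_pos.2 hx)]
    have := mul_le_mul_of_nonneg_on_roots (b := QuadraticMap.polar G x y) (f := F x)
      (c := QuadraticMap.polar F x y) (g := F y) hx hy fun t ht => by
        rw [← map_add_smul_eq] at ht ⊢
        exact h _ ht.le
    linarith
  obtain ⟨z, hz⟩ := hG
  let s : Set ℝ := insert 0 {r | ∃ y, 0 < G y ∧ r = -F y / G y}
  have hs {x : V} (hx : G x < 0) : F x / -G x ∈ upperBounds s := by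
    rintro r (rfl | ⟨y, hy, rfl⟩)
    · exact div_nonneg (h x hx.le) (neg_nonneg.2 hx.le)
    · exact cross hx hy
  have hbdd : BddAbove s := ⟨_, hs hz⟩
  have h0 : (0 : ℝ) ∈ s := Set.mem_insert _ _
  refine ⟨sSup s, le_csSup hbdd h0, fun x => ?_⟩
  rcases lt_trichotomy (G x) 0 with hx | hx | hx
  · have := csSup_le ⟨0, h0⟩ (hs hx)
    rw [le_div_iff₀ (neg_pos.2 hx)] at this
    linarith
  · simpa [hx] using h x hx.le
  · have := le_csSup hbdd (Set.mem_insert_of_mem 0 ⟨x, hx, rfl⟩ : -F x / G x ∈ s)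
    rw [div_le_iff₀ hx] at this
    linarith

/-- The symmetric bordered matrix `[[A, b], [bᵀ, c]]`. -/
def borderedMatrix {n : Type*} (A : Matrix n n ℝ) (b : n → ℝ) (c : ℝ) :
    Matrix (n ⊕ Fin 1) (n ⊕ Fin 1) ℝ :=
  Matrix.fromBlocks A (Matrix.of fun i _ => b i) (Matrix.of fun _ j => b j)
    (Matrix.of fun _ _ => c)

theorem dotProduct_borderedMatrix_mulVec {n : Type*} [Fintype n] (A : Matrix n n ℝ) (b : n → ℝ)
    (c : ℝ) (v : n ⊕ Fin 1 → ℝ) :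
    v ⬝ᵥ (borderedMatrix A b c) *ᵥ v =
      (v ∘ Sum.inl) ⬝ᵥ A *ᵥ (v ∘ Sum.inl) + 2 * v (Sum.inr 0) * (b ⬝ᵥ (v ∘ Sum.inl)) +
        c * v (Sum.inr 0) ^ 2 := by
  have h₁ : (Matrix.of fun i (_ : Fin 1) => b i) *ᵥ (v ∘ Sum.inr) = v (Sum.inr 0) • b := by
    ext i; simp [Matrix.mulVec, dotProduct, mul_comm]
  have h₀ (x : n → ℝ) (y : Fin 1 → ℝ) :
      v ⬝ᵥ Sum.elim x y = (v ∘ Sum.inl) ⬝ᵥ x + (v ∘ Sum.inr) ⬝ᵥ y := by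
    simp [dotProduct]
  rw [borderedMatrix, Matrix.fromBlocks_mulVec, h₁, h₀, dotProduct_add, dotProduct_add,
    dotProduct_smul, dotProduct_comm (v ∘ Sum.inl) b]
  have h₂ : (v ∘ Sum.inr) ⬝ᵥ ((Matrix.of fun (_ : Fin 1) j => b j) *ᵥ (v ∘ Sum.inl)) =
      v (Sum.inr 0) * (b ⬝ᵥ (v ∘ Sum.inl)) := by
    simp [Matrix.mulVec, dotProduct]
  have h₃ : (v ∘ Sum.inr) ⬝ᵥ ((Matrix.of fun (_ _ : Fin 1) => c) *ᵥ (v ∘ Sum.inr)) =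
      c * v (Sum.inr 0) ^ 2 := by
    simp [Matrix.mulVec, dotProduct]; ring
  rw [h₂, h₃, smul_eq_mul]
  ring

theorem borderedMatrix_toQuadraticForm'_apply {n : Type*} [Fintype n] [DecidableEq n]
    (A : Matrix n n ℝ) (b : n → ℝ) (c : ℝ) (v : n ⊕ Fin 1 → ℝ) :
    (borderedMatrix A b c).toQuadraticForm' v =
      (v ∘ Sum.inl) ⬝ᵥ A *ᵥ (v ∘ Sum.inl) + 2 * v (Sum.inr 0) * (b ⬝ᵥ (v ∘ Sum.inl)) +
        c * v (Sum.inr 0) ^ 2 := by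
  rw [← dotProduct_borderedMatrix_mulVec]
  simp [Matrix.toQuadraticForm', Matrix.toLinearMap₂'_apply']

theorem borderedMatrix_isHermitian {n : Type*} {A : Matrix n n ℝ} (hA : A.IsSymm) (b : n → ℝ)
    (c : ℝ) : (borderedMatrix A b c).IsHermitian := by
  refine Matrix.IsHermitian.fromBlocks ?_ ?_ ?_
  · simpa [Matrix.IsHermitian] using hA.eq
  · ext; simp
  · ext; simp

/-- A quadratic function evaluated along a line. -/
theorem quadratic_add_smul {n : Type*} [Fintype n] (A : Matrix n n ℝ) (b : n → ℝ) (c : ℝ)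
    (z w : n → ℝ) (t : ℝ) :
    (z + t • w) ⬝ᵥ A *ᵥ (z + t • w) + 2 * (b ⬝ᵥ (z + t • w)) + c =
      (z ⬝ᵥ A *ᵥ z + 2 * (b ⬝ᵥ z) + c) +
        (z ⬝ᵥ A *ᵥ w + w ⬝ᵥ A *ᵥ z + 2 * (b ⬝ᵥ w)) * t + (w ⬝ᵥ A *ᵥ w) * t ^ 2 := by
  simp only [Matrix.mulVec_add, Matrix.mulVec_smul, dotProduct_add, add_dotProduct,
    smul_dotProduct, dotProduct_smul, smul_eq_mul]
  ring

/-- Under the Slater condition, an implication between quadratic inequalities passes to the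
quadratic parts. -/
theorem quadratic_part_nonneg {n : Type*} [Fintype n] {A₁ A₂ : Matrix n n ℝ} {b₁ b₂ : n → ℝ}
    {c₁ c₂ : ℝ} {z : n → ℝ} (hz : z ⬝ᵥ A₂ *ᵥ z + 2 * (b₂ ⬝ᵥ z) + c₂ < 0)
    (h : ∀ o : n → ℝ, o ⬝ᵥ A₂ *ᵥ o + 2 * (b₂ ⬝ᵥ o) + c₂ ≤ 0 →
      0 ≤ o ⬝ᵥ A₁ *ᵥ o + 2 * (b₁ ⬝ᵥ o) + c₁)
    {w : n → ℝ} (hw : w ⬝ᵥ A₂ *ᵥ w ≤ 0) : 0 ≤ w ⬝ᵥ A₁ *ᵥ w := by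
  wlog hl : z ⬝ᵥ A₂ *ᵥ w + w ⬝ᵥ A₂ *ᵥ z + 2 * (b₂ ⬝ᵥ w) ≤ 0 generalizing w
  · have := this (w := -w) (by simpa [Matrix.mulVec_neg] using hw) (by
      simp only [Matrix.mulVec_neg, dotProduct_neg, neg_dotProduct]; linarith)
    simpa [Matrix.mulVec_neg] using this
  refine nonneg_of_forall_quadratic_nonneg (a := z ⬝ᵥ A₁ *ᵥ z + 2 * (b₁ ⬝ᵥ z) + c₁)
    (b := z ⬝ᵥ A₁ *ᵥ w + w ⬝ᵥ A₁ *ᵥ z + 2 * (b₁ ⬝ᵥ w)) fun t ht => ?_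
  rw [← quadratic_add_smul]
  apply h
  rw [quadratic_add_smul]
  linarith [mul_nonpos_of_nonpos_of_nonneg hl ht,
    mul_nonpos_of_nonpos_of_nonneg hw (sq_nonneg t)]

theorem borderedMatrix_implication {n : Type*} [Fintype n] [DecidableEq n]
    {A₁ A₂ : Matrix n n ℝ} {b₁ b₂ : n → ℝ} {c₁ c₂ : ℝ}
    (hSlater : ∃ z : n → ℝ, z ⬝ᵥ A₂ *ᵥ z + 2 * (b₂ ⬝ᵥ z) + c₂ < 0)
    (h : ∀ o : n → ℝ, o ⬝ᵥ A₂ *ᵥ o + 2 * (b₂ ⬝ᵥ o) + c₂ ≤ 0 →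
      0 ≤ o ⬝ᵥ A₁ *ᵥ o + 2 * (b₁ ⬝ᵥ o) + c₁)
    (v : n ⊕ Fin 1 → ℝ) (hv : (borderedMatrix A₂ b₂ c₂).toQuadraticForm' v ≤ 0) :
    0 ≤ (borderedMatrix A₁ b₁ c₁).toQuadraticForm' v := by
  obtain ⟨z, hz⟩ := hSlater
  rw [borderedMatrix_toQuadraticForm'_apply] at hv ⊢
  set w := v ∘ Sum.inl
  set s := v (Sum.inr 0)
  by_cases hs : s = 0
  · simp only [hs, mul_zero, zero_mul, add_zero, ne_eq, OfNat.ofNat_ne_zero, not_false_eq_true,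
      zero_pow] at hv ⊢
    exact quadratic_part_nonneg hz h hv
  · have scale (A : Matrix n n ℝ) (b : n → ℝ) (c : ℝ) :
        w ⬝ᵥ A *ᵥ w + 2 * s * (b ⬝ᵥ w) + c * s ^ 2 =
          s ^ 2 * ((s⁻¹ • w) ⬝ᵥ A *ᵥ (s⁻¹ • w) + 2 * (b ⬝ᵥ (s⁻¹ • w)) + c) := by
      simp only [Matrix.mulVec_smul, smul_dotProduct, dotProduct_smul, smul_eq_mul]
      field_simp
    have hs2 : 0 < s ^ 2 := by positivity
    rw [scale] at hv ⊢
    exact mul_nonneg hs2.le (h _ (nonpos_of_mul_nonpos_right hv hs2))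

/-- S-procedure lemma for two real quadratic functions. -/
theorem s_procedure
    (M : ℕ) (hM : 0 < M)
    (A₁ A₂ : Matrix (Fin M) (Fin M) ℝ) (hA₁ : A₁.IsSymm) (hA₂ : A₂.IsSymm)
    (b₁ b₂ : Fin M → ℝ) (c₁ c₂ : ℝ)
    (hSlater : ∃ o : Fin M → ℝ,
      o ⬝ᵥ A₂.mulVec o + 2 * (b₂ ⬝ᵥ o) + c₂ < 0) :
    (∀ o : Fin M → ℝ,
        o ⬝ᵥ A₂.mulVec o + 2 * (b₂ ⬝ᵥ o) + c₂ ≤ 0 →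
        0 ≤ o ⬝ᵥ A₁.mulVec o + 2 * (b₁ ⬝ᵥ o) + c₁) ↔
      ∃ κ : ℝ, 0 ≤ κ ∧
        (Matrix.fromBlocks
          (A₁ + κ • A₂)
          (Matrix.of fun i (_ : Fin 1) => b₁ i + κ * b₂ i)
          (Matrix.of fun (_ : Fin 1) j => b₁ j + κ * b₂ j)
          (Matrix.of fun (_ : Fin 1) (_ : Fin 1) => c₁ + κ * c₂)).PosSemidef := by
  have split (κ : ℝ) (v : Fin M ⊕ Fin 1 → ℝ) :
      v ⬝ᵥ (borderedMatrix (A₁ + κ • A₂) (b₁ + κ • b₂) (c₁ + κ * c₂)) *ᵥ v =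
        (borderedMatrix A₁ b₁ c₁).toQuadraticForm' v +
          κ * (borderedMatrix A₂ b₂ c₂).toQuadraticForm' v := by
    rw [dotProduct_borderedMatrix_mulVec, borderedMatrix_toQuadraticForm'_apply,
      borderedMatrix_toQuadraticForm'_apply]
    simp only [Matrix.add_mulVec, Matrix.smul_mulVec, dotProduct_add, add_dotProduct,
      smul_dotProduct, dotProduct_smul, smul_eq_mul]
    ring
  have eval_one (A : Matrix (Fin M) (Fin M) ℝ) (b : Fin M → ℝ) (c : ℝ) (o : Fin M → ℝ) :
      (borderedMatrix A b c).toQuadraticForm' (Sum.elim o fun _ => 1) =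
        o ⬝ᵥ A *ᵥ o + 2 * (b ⬝ᵥ o) + c := by
    simp [borderedMatrix_toQuadraticForm'_apply]
  change _ ↔ ∃ κ : ℝ, 0 ≤ κ ∧
    (borderedMatrix (A₁ + κ • A₂) (b₁ + κ • b₂) (c₁ + κ * c₂)).PosSemidef
  constructor
  · intro h
    obtain ⟨κ, hκ, hnn⟩ := QuadraticMap.exists_nonneg_add_mul_nonneg
      (borderedMatrix A₁ b₁ c₁).toQuadraticForm' (borderedMatrix A₂ b₂ c₂).toQuadraticForm'
      (hSlater.imp' (Sum.elim · fun _ => 1) fun o ho => by rwa [eval_one])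
      (borderedMatrix_implication hSlater h)
    refine ⟨κ, hκ, Matrix.PosSemidef.of_dotProduct_mulVec_nonneg
      (borderedMatrix_isHermitian (hA₁.add (hA₂.smul κ)) _ _) fun v => ?_⟩
    rw [star_trivial, split]
    exact hnn v
  · rintro ⟨κ, hκ, hpsd⟩ o ho
    have := hpsd.dotProduct_mulVec_nonneg (Sum.elim o fun _ => 1)
    rw [star_trivial, split, eval_one, eval_one] at this
    linarith [mul_nonpos_of_nonneg_of_nonpos hκ ho]
end

section
/- Let n, K be positive integers, let V be a real symmetric positive semidefinite n×n matrix, H̆ a real K×n matrix, η ≥ 0, and ε ∈ ℝ. Suppose there exist κ ≥ 0 and a real symmetric n×n matrix W such that (i) tr((V + W) H̆ᵀ H̆) ≤ ε − 2κη², and (ii) the 2n×2n block matrix [[κI − V, V], [V, W]] is positive semidefinite. Then for every real K×n matrix Ĕ with tr(Ĕ Ĕᵀ) ≤ 2η², one has tr((H̆ + Ĕ) V (H̆ + Ĕ)ᵀ) ≤ ε. -/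
open Matrix

/-- The trace form of positive semidefiniteness for a real block matrix, tested on `[E, -H]`. -/
theorem Matrix.PosSemidef.trace_fromBlocks_nonneg {k m n : Type*} [Fintype k] [Fintype m]
    [Fintype n] {A : Matrix m m ℝ} {B : Matrix m n ℝ} {C : Matrix n m ℝ} {D : Matrix n n ℝ}
    (h : (Matrix.fromBlocks A B C D).PosSemidef) (E : Matrix k m ℝ) (H : Matrix k n ℝ) :
    0 ≤ (E * A * Eᵀ).trace - (H * C * Eᵀ).trace - (E * B * Hᵀ).trace + (H * D * Hᵀ).trace := by
  have key := (h.mul_mul_conjTranspose_same (Matrix.fromCols E (-H))).trace_nonneg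
  rw [Matrix.conjTranspose_eq_transpose_of_trivial, Matrix.transpose_fromCols,
    Matrix.fromCols_mul_fromBlocks, Matrix.fromCols_mul_fromRows] at key
  simp only [Matrix.transpose_neg, Matrix.add_mul, Matrix.neg_mul, Matrix.mul_neg,
    Matrix.trace_add, Matrix.trace_neg] at key
  linarith

/-- Soundness of the robust relaxation in Theorem 1. -/
theorem robust_relaxation_sound
    (n K : ℕ) (hn : 0 < n) (hK : 0 < K)
    (V : Matrix (Fin n) (Fin n) ℝ) (hVsymm : V.IsSymm) (hVpsd : V.PosSemidef)
    (H : Matrix (Fin K) (Fin n) ℝ) (η : ℝ) (hη : 0 ≤ η) (ε : ℝ)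
    (hfeas : ∃ κ : ℝ, 0 ≤ κ ∧ ∃ W : Matrix (Fin n) (Fin n) ℝ, W.IsSymm ∧
      ((V + W) * Hᵀ * H).trace ≤ ε - 2 * κ * η ^ 2 ∧
      (Matrix.fromBlocks (κ • (1 : Matrix (Fin n) (Fin n) ℝ) - V) V V W).PosSemidef) :
    ∀ E : Matrix (Fin K) (Fin n) ℝ, (E * Eᵀ).trace ≤ 2 * η ^ 2 →
      ((H + E) * V * (H + E)ᵀ).trace ≤ ε := by
  intro E hE
  obtain ⟨κ, hκ, W, -, htr, hpsd⟩ := hfeas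
  have key := hpsd.trace_fromBlocks_nonneg E H
  have hscale := mul_le_mul_of_nonneg_left hE hκ
  rw [Matrix.mul_assoc, Matrix.trace_mul_comm, Matrix.mul_assoc, Matrix.trace_mul_comm] at htr
  simp only [Matrix.transpose_add, Matrix.mul_add, Matrix.add_mul, Matrix.mul_sub,
    Matrix.sub_mul, Matrix.trace_add, Matrix.trace_sub, Matrix.mul_smul, Matrix.smul_mul,
    Matrix.mul_one, Matrix.trace_smul, smul_eq_mul] at key htr ⊢
  linarith
end

section
/- Let n be a positive integer, A a real symmetric n×n matrix, b ∈ ℝⁿ, c ∈ ℝ, and ρ > 0. Then the robust constraint 'eᵀAe + 2bᵀe + c ≤ 0 for every e ∈ ℝⁿ with ‖e‖₂² ≤ ρ' holds if and only if there exists κ ≥ 0 such that the (n+1)×(n+1) block matrix [[κI − A, −b], [−bᵀ, −c − κρ]] is positive semidefinite. -/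
open Matrix

/-- The value of the quadratic form of a symmetric matrix at `x + t • d`. -/
lemma Matrix.IsSymm.dotProduct_mulVec_add_smul {ι : Type*} [Fintype ι] {A : Matrix ι ι ℝ}
    (hA : A.IsSymm) (x d : ι → ℝ) (t : ℝ) :
    (x + t • d) ⬝ᵥ A.mulVec (x + t • d) =
      x ⬝ᵥ A.mulVec x + 2 * t * (d ⬝ᵥ A.mulVec x) + t ^ 2 * (d ⬝ᵥ A.mulVec d) := by
  have h : x ⬝ᵥ A.mulVec d = d ⬝ᵥ A.mulVec x := by
    rw [dotProduct_mulVec, ← mulVec_transpose, hA.eq, dotProduct_comm]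
  simp only [mulVec_add, mulVec_smul, dotProduct_add, add_dotProduct, smul_dotProduct,
    dotProduct_smul, smul_eq_mul, h]
  ring

lemma dotProduct_self_add_smul {ι : Type*} [Fintype ι] (x d : ι → ℝ) (t : ℝ) :
    (x + t • d) ⬝ᵥ (x + t • d) = x ⬝ᵥ x + 2 * t * (d ⬝ᵥ x) + t ^ 2 * (d ⬝ᵥ d) := by
  simp only [dotProduct_add, add_dotProduct, smul_dotProduct, dotProduct_smul, smul_eq_mul,
    dotProduct_comm x d]
  ring

/-- If `a * t + b * t ^ 2 ≤ 0` for all small `t > 0`, then `a ≤ 0`. -/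
lemma nonpos_of_forall_small_mul_add_mul_sq_nonpos {a b δ : ℝ} (hδ : 0 < δ)
    (h : ∀ t, 0 < t → t < δ → a * t + b * t ^ 2 ≤ 0) : a ≤ 0 := by
  by_contra! ha
  set t := min (δ / 2) (a / (2 * (|b| + 1)))
  have ht0 : 0 < t := by positivity
  have h1 : t < δ := (min_le_left _ _).trans_lt (by linarith)
  have h2 : t * (2 * (|b| + 1)) ≤ a := (le_div_iff₀ (by positivity)).1 (min_le_right _ _)
  have h3 := h t ht0 h1
  have h4 : a + b * t ≤ 0 := by
    by_contra! h5
    nlinarith [mul_pos ht0 h5]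
  nlinarith [neg_abs_le b]

/-- If `a + b * t + c * t ^ 2 ≤ 0` for all small `t > 0`, then `a ≤ 0`. -/
lemma nonpos_of_forall_small_add_mul_add_mul_sq_nonpos {a b c δ : ℝ} (hδ : 0 < δ)
    (h : ∀ t, 0 < t → t < δ → a + b * t + c * t ^ 2 ≤ 0) : a ≤ 0 := by
  have hc : Continuous fun t : ℝ => a + b * t + c * t ^ 2 := by fun_prop
  have hlim : Filter.Tendsto (fun t : ℝ => a + b * t + c * t ^ 2)
      (nhdsWithin 0 (Set.Ioi 0)) (nhds a) := by
    simpa using (hc.tendsto 0).mono_left nhdsWithin_le_nhds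
  refine le_of_tendsto hlim ?_
  filter_upwards [Ioo_mem_nhdsGT hδ] with t ht using h t ht.1 ht.2

lemma isCompact_setOf_dotProduct_self_le {ι : Type*} [Fintype ι] (ρ : ℝ) :
    IsCompact {e : ι → ℝ | e ⬝ᵥ e ≤ ρ} := by
  refine Metric.isCompact_of_isClosed_isBounded
    (isClosed_le (by unfold dotProduct; fun_prop) continuous_const) ?_
  refine (Metric.isBounded_closedBall (x := (0 : ι → ℝ)) (r := √ρ)).subset fun e he => ?_
  rw [mem_closedBall_zero_iff, pi_norm_le_iff_of_nonneg (Real.sqrt_nonneg _)]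
  intro i
  refine Real.abs_le_sqrt (le_trans ?_ he)
  rw [sq]
  exact Finset.single_le_sum (f := fun i => e i * e i) (fun i _ => mul_self_nonneg _)
    (Finset.mem_univ i)

/-- Optimality conditions, with a Lagrange multiplier `κ`, for a maximizer of a quadratic function
over a Euclidean ball. -/
lemma exists_multiplier_of_isMaxOn_ball {ι : Type*} [Fintype ι] {A : Matrix ι ι ℝ}
    (hA : A.IsSymm) (b : ι → ℝ) {ρ : ℝ} (hρ : 0 < ρ) {x : ι → ℝ} (hx : x ⬝ᵥ x ≤ ρ)
    (hmax : ∀ e : ι → ℝ, e ⬝ᵥ e ≤ ρ →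
      e ⬝ᵥ A.mulVec e + 2 * (b ⬝ᵥ e) ≤ x ⬝ᵥ A.mulVec x + 2 * (b ⬝ᵥ x)) :
    ∃ κ : ℝ, 0 ≤ κ ∧ κ * (x ⬝ᵥ x - ρ) = 0 ∧ A.mulVec x + b = κ • x ∧
      ∀ d : ι → ℝ, d ⬝ᵥ A.mulVec d ≤ κ * (d ⬝ᵥ d) := by
  set g := A.mulVec x + b with hg
  have hmax' : ∀ (d : ι → ℝ) (t : ℝ), 2 * t * (d ⬝ᵥ x) + t ^ 2 * (d ⬝ᵥ d) ≤ ρ - x ⬝ᵥ x →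
      2 * t * (d ⬝ᵥ g) + t ^ 2 * (d ⬝ᵥ A.mulVec d) ≤ 0 := by
    intro d t h
    have := hmax (x + t • d) (by rw [dotProduct_self_add_smul]; linarith)
    rw [hA.dotProduct_mulVec_add_smul, dotProduct_add, dotProduct_smul, smul_eq_mul,
      dotProduct_comm b d] at this
    rw [hg, dotProduct_add]
    linarith
  have hsmall : ∀ d : ι → ℝ, (x ⬝ᵥ x < ρ ∨ d ⬝ᵥ x < 0) → ∃ δ > 0, ∀ t, 0 < t → t < δ →
      2 * t * (d ⬝ᵥ x) + t ^ 2 * (d ⬝ᵥ d) ≤ ρ - x ⬝ᵥ x := by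
    intro d hd
    by_contra! hcon
    have hle : ρ - x ⬝ᵥ x ≤ 0 := by
      have hc : Continuous fun t : ℝ => 2 * t * (d ⬝ᵥ x) + t ^ 2 * (d ⬝ᵥ d) := by fun_prop
      by_contra! hpos
      have hev := (hc.tendsto' 0 0 (by simp)).eventually (gt_mem_nhds hpos)
      obtain ⟨δ, hδ, hball⟩ := Metric.eventually_nhds_iff.1 hev
      obtain ⟨t, ht, htδ, hlt⟩ := hcon δ hδ
      have := hball (y := t) (by simpa [abs_of_pos ht] using htδ)
      linarith
    have hdx : d ⬝ᵥ x < 0 := hd.resolve_left (by linarith)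
    have hD : 0 ≤ d ⬝ᵥ d := Finset.sum_nonneg fun i _ => mul_self_nonneg _
    obtain ⟨t, ht, htδ, hlt⟩ := hcon (-(d ⬝ᵥ x) / (d ⬝ᵥ d + 1))
      (div_pos (by linarith) (by linarith))
    rw [lt_div_iff₀ (by linarith)] at htδ
    nlinarith [mul_pos ht (show 0 < -(d ⬝ᵥ x) - t * (d ⬝ᵥ d + 1) by linarith),
      mul_pos ht (neg_pos.2 hdx), mul_pos ht ht]
  have hfirst : ∀ d : ι → ℝ, (x ⬝ᵥ x < ρ ∨ d ⬝ᵥ x < 0) → d ⬝ᵥ g ≤ 0 := by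
    intro d hd
    obtain ⟨δ, hδ, h⟩ := hsmall d hd
    have := nonpos_of_forall_small_mul_add_mul_sq_nonpos (a := 2 * (d ⬝ᵥ g))
      (b := d ⬝ᵥ A.mulVec d) hδ fun t ht htδ => by linarith [hmax' d t (h t ht htδ)]
    linarith
  rcases hx.lt_or_eq with hlt | heq
  · have hg0 : g = 0 := dotProduct_self_eq_zero.1
      (le_antisymm (hfirst g (.inl hlt)) (Finset.sum_nonneg fun i _ => mul_self_nonneg _))
    refine ⟨0, le_rfl, by simp, by simpa using hg0, fun d => ?_⟩
    obtain ⟨δ, hδ, h⟩ := hsmall d (.inl hlt)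
    have h1 := hmax' d (δ / 2) (h _ (by linarith) (by linarith))
    rw [hg0, dotProduct_zero] at h1
    have : 0 < (δ / 2) ^ 2 := by positivity
    nlinarith
  · set κ := (x ⬝ᵥ g) / ρ
    have hκρ : κ * ρ = x ⬝ᵥ g := div_mul_cancel₀ _ hρ.ne'
    have hκ0 : 0 ≤ κ := by
      have := hfirst (-x) (.inr (by rw [neg_dotProduct]; linarith))
      rw [neg_dotProduct] at this
      exact div_nonneg (by linarith) hρ.le
    have hgx : g = κ • x := by
      set p := g - κ • x with hp
      have hpx : p ⬝ᵥ x = 0 := by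
        rw [hp, sub_dotProduct, smul_dotProduct, smul_eq_mul, heq, dotProduct_comm g x]
        linarith
      have hpg : p ⬝ᵥ g = p ⬝ᵥ p := by
        have : g = p + κ • x := by simp [hp]
        conv_lhs => rw [this]
        rw [dotProduct_add, dotProduct_smul, hpx]
        simp
      have hpp : p ⬝ᵥ p ≤ 0 := by
        refine nonpos_of_forall_small_add_mul_add_mul_sq_nonpos (b := -(κ * ρ)) (c := 0)
          one_pos fun t ht _ => ?_
        have := hfirst (p - t • x) (.inr (by
          rw [sub_dotProduct, smul_dotProduct, hpx, heq, smul_eq_mul]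
          nlinarith))
        rw [sub_dotProduct, smul_dotProduct, hpg, ← hκρ, smul_eq_mul] at this
        linarith
      exact sub_eq_zero.1 (dotProduct_self_eq_zero.1
        (le_antisymm hpp (Finset.sum_nonneg fun i _ => mul_self_nonneg _)))
    have hsecond : ∀ d : ι → ℝ, d ⬝ᵥ x ≠ 0 → d ⬝ᵥ A.mulVec d ≤ κ * (d ⬝ᵥ d) := by
      intro d hd
      have hD : d ⬝ᵥ d ≠ 0 := by
        intro h
        rw [dotProduct_self_eq_zero.1 h, zero_dotProduct] at hd
        exact hd rfl
      obtain ⟨t, ht⟩ : ∃ t, t * (d ⬝ᵥ d) = -(2 * (d ⬝ᵥ x)) := ⟨_, div_mul_cancel₀ _ hD⟩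
      have ht0 : t ≠ 0 := by
        rintro rfl
        apply hd
        linarith
      have h := hmax' d t (by rw [heq]; linear_combination t * ht)
      rw [hgx, dotProduct_smul, smul_eq_mul] at h
      have h2 : t ^ 2 * (d ⬝ᵥ A.mulVec d - κ * (d ⬝ᵥ d)) ≤ 0 := by
        linear_combination h - t * κ * ht
      have := nonpos_of_mul_nonpos_right h2 (by positivity)
      linarith
    refine ⟨κ, hκ0, by rw [heq]; ring, hgx, fun d => ?_⟩
    by_cases hd : d ⬝ᵥ x = 0
    · suffices d ⬝ᵥ A.mulVec d - κ * (d ⬝ᵥ d) ≤ 0 by linarith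
      refine nonpos_of_forall_small_add_mul_add_mul_sq_nonpos
        (b := 2 * (x ⬝ᵥ A.mulVec d) - κ * (2 * (x ⬝ᵥ d)))
        (c := x ⬝ᵥ A.mulVec x - κ * (x ⬝ᵥ x)) one_pos fun t ht _ => ?_
      have := hsecond (d + t • x) (by
        rw [add_dotProduct, smul_dotProduct, hd, heq, smul_eq_mul]
        positivity)
      rw [hA.dotProduct_mulVec_add_smul, dotProduct_self_add_smul] at this
      linarith
    · exact hsecond d hd

/-- The quadratic form of the block matrix of the S-procedure for a ball. -/
lemma dotProduct_fromBlocks_mulVec_sumElim {n : ℕ} (A : Matrix (Fin n) (Fin n) ℝ)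
    (b : Fin n → ℝ) (c ρ κ : ℝ) (x : Fin n → ℝ) (s : Fin 1 → ℝ) :
    Sum.elim x s ⬝ᵥ (Matrix.fromBlocks
      (κ • (1 : Matrix (Fin n) (Fin n) ℝ) - A)
      (Matrix.of fun i (_ : Fin 1) => -b i)
      (Matrix.of fun (_ : Fin 1) j => -b j)
      (Matrix.of fun (_ : Fin 1) (_ : Fin 1) => -c - κ * ρ)).mulVec (Sum.elim x s) =
    κ * (x ⬝ᵥ x) - x ⬝ᵥ A.mulVec x - 2 * s 0 * (b ⬝ᵥ x) - s 0 ^ 2 * (c + κ * ρ) := by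
  have h1 : (Matrix.of fun i (_ : Fin 1) => -b i).mulVec s = (-s 0) • b := by
    ext i
    simp [mulVec, dotProduct, mul_comm]
  have h2 : (Matrix.of fun (_ : Fin 1) j => -b j).mulVec x = fun _ => -(b ⬝ᵥ x) := by
    ext i
    simp [mulVec, dotProduct]
  have h3 : (Matrix.of fun (_ : Fin 1) (_ : Fin 1) => -c - κ * ρ).mulVec s =
      fun _ => (-c - κ * ρ) * s 0 := by
    ext i
    simp [mulVec, dotProduct]
  rw [fromBlocks_mulVec, sumElim_dotProduct_sumElim]
  simp only [Sum.elim_comp_inl, Sum.elim_comp_inr, h1, h2, h3, sub_mulVec, smul_mulVec,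
    one_mulVec, dotProduct_add, dotProduct_sub, dotProduct_smul, smul_eq_mul,
    dotProduct_comm x b]
  simp [dotProduct]
  ring

/-- S-procedure specialized to a quadratic constraint over a Euclidean ball. -/
theorem s_procedure_ball
    (n : ℕ) (hn : 0 < n)
    (A : Matrix (Fin n) (Fin n) ℝ) (hA : A.IsSymm)
    (b : Fin n → ℝ) (c ρ : ℝ) (hρ : 0 < ρ) :
    (∀ e : Fin n → ℝ, (∑ i, e i ^ 2) ≤ ρ →
        e ⬝ᵥ A.mulVec e + 2 * (b ⬝ᵥ e) + c ≤ 0) ↔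
      ∃ κ : ℝ, 0 ≤ κ ∧
        (Matrix.fromBlocks
          (κ • (1 : Matrix (Fin n) (Fin n) ℝ) - A)
          (Matrix.of fun i (_ : Fin 1) => -b i)
          (Matrix.of fun (_ : Fin 1) j => -b j)
          (Matrix.of fun (_ : Fin 1) (_ : Fin 1) => -c - κ * ρ)).PosSemidef := by
  have hsq : ∀ e : Fin n → ℝ, ∑ i, e i ^ 2 = e ⬝ᵥ e := fun e => by simp [dotProduct, sq]
  simp only [hsq]
  constructor
  · intro h
    obtain ⟨x, hx, hmax⟩ := (isCompact_setOf_dotProduct_self_le (ι := Fin n) ρ).exists_isMaxOn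
      ⟨0, by simpa using hρ.le⟩
      (f := fun e => e ⬝ᵥ A.mulVec e + 2 * (b ⬝ᵥ e))
      (by unfold mulVec dotProduct; fun_prop)
    obtain ⟨κ, hκ, hslack, hstat, hcurv⟩ :=
      exists_multiplier_of_isMaxOn_ball hA b hρ hx fun e he => hmax he
    refine ⟨κ, hκ, .of_dotProduct_mulVec_nonneg ?_ fun v => ?_⟩
    · refine IsHermitian.fromBlocks ?_ ?_ ?_
      · rw [IsHermitian, conjTranspose_eq_transpose_of_trivial, transpose_sub, transpose_smul,
          transpose_one, hA.eq]
      · ext i j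
        simp
      · ext i j
        simp
    · rw [star_trivial, ← Sum.elim_comp_inl_inr v, dotProduct_fromBlocks_mulVec_sumElim]
      set s := (v ∘ Sum.inr) 0
      obtain ⟨d, hd⟩ : ∃ d, v ∘ Sum.inl = d + s • x := ⟨v ∘ Sum.inl - s • x, by simp⟩
      have hb : b = κ • x - A.mulVec x := by rw [← hstat]; simp
      have hq := h x hx
      have hcross : b ⬝ᵥ d = κ * (x ⬝ᵥ d) - x ⬝ᵥ A.mulVec d := by
        rw [hb, sub_dotProduct, smul_dotProduct, smul_eq_mul, dotProduct_mulVec,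
          ← mulVec_transpose, hA.eq]
      rw [hd, hA.dotProduct_mulVec_add_smul, dotProduct_self_add_smul, dotProduct_add,
        dotProduct_smul, smul_eq_mul, hcross]
      nlinarith [hcurv d, mul_nonneg (sq_nonneg s) (neg_nonneg.2 hq),
        congrArg (fun r => s ^ 2 * r) hslack]
  · rintro ⟨κ, hκ, hP⟩ e he
    have h := hP.dotProduct_mulVec_nonneg (Sum.elim e fun _ => 1)
    rw [star_trivial, dotProduct_fromBlocks_mulVec_sumElim] at h
    nlinarith [mul_nonneg hκ (sub_nonneg.2 he)]
end
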